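/- Let R be a commutative ring and x_1, x_2, x_3, … a sequence of elements of R. For all n, k ∈ ℕ: Σ_{i=0}^{n} (−1)^{n−i} · e_{n−i}(x_1,…,x_n) · h_{i−k}(x_1,…,x_{k+1}) = δ_{n,k}, where h_{i−k} is interpreted as 0 when i < k. In other words, the infinite lower-triangular matrices E = [(−1)^{n−k} e_{n−k}(x_1,…,x_n)]_{n,k≥0} and H = [h_{n−k}(x_1,…,x_{k+1})]_{n,k≥0} satisfy EH = I. -/

import Mathlib

open Finset

/-- The j-th elementary symmetric polynomial in the values x 0, ..., x (m-1). -/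
noncomputable def esym {R : Type*} [CommRing R] (x : ℕ → R) (m j : ℕ) : R :=
  ∑ S ∈ (Finset.range m).powersetCard j, ∏ i ∈ S, x i

/-- The j-th complete homogeneous symmetric polynomial in x 0, ..., x (m-1). -/
noncomputable def hsym {R : Type*} [CommRing R] (x : ℕ → R) (m j : ℕ) : R :=
  ∑ t ∈ (Finset.range m).sym j, ((t : Multiset ℕ).map x).prod

theorem aux_esym_succ {R : Type*} [CommRing R] (x : ℕ → R) (m j : ℕ) :
    esym x (m+1) (j+1) = esym x m (j+1) + x m * esym x m j := by
  unfold esym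
  have hm : m ∉ Finset.range m := by simp
  rw [Finset.range_add_one, Finset.powersetCard_succ_insert hm, Finset.sum_union, Finset.sum_image,
    Finset.mul_sum]
  · congr 1
    apply Finset.sum_congr rfl
    intro S hS
    rw [Finset.prod_insert]
    intro h
    exact hm ((Finset.mem_powersetCard.1 hS).1 h)
  · intro S hS T hT h
    have hS' : m ∉ S := fun h => hm ((Finset.mem_powersetCard.1 hS).1 h)
    have hT' : m ∉ T := fun h => hm ((Finset.mem_powersetCard.1 hT).1 h)
    rw [← Finset.erase_insert hS', ← Finset.erase_insert hT', h]
  · rw [Finset.disjoint_left]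
    intro S hS hT
    obtain ⟨T, _, rfl⟩ := Finset.mem_image.1 hT
    exact hm ((Finset.mem_powersetCard.1 hS).1 (Finset.mem_insert_self _ _))

theorem aux_esym_zero {R : Type*} [CommRing R] (x : ℕ → R) (m : ℕ) : esym x m 0 = 1 := by
  simp [esym]

theorem aux_hsym_zero {R : Type*} [CommRing R] (x : ℕ → R) (m : ℕ) : hsym x m 0 = 1 := by
  simp only [hsym, Finset.sym_zero, Finset.sum_singleton]
  change (Multiset.map x 0).prod = 1
  simp

theorem aux_hsym_succ {R : Type*} [CommRing R] (x : ℕ → R) (m j : ℕ) :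
    hsym x (m+1) (j+1) = hsym x m (j+1) + x m * hsym x (m+1) j := by
  unfold hsym
  have hm : m ∉ Finset.range m := by simp
  have hU : (Finset.range (m+1)).sym (j+1) =
      (Finset.range m).sym (j+1) ∪ ((Finset.range (m+1)).sym j).image (Sym.cons m) := by
    ext t
    simp only [Finset.mem_union, Finset.mem_image, Finset.mem_sym_iff]
    constructor
    · intro h
      by_cases hmt : m ∈ t
      · right
        obtain ⟨s, rfl⟩ := Sym.exists_cons_of_mem hmt
        exact ⟨s, fun a ha => h a (Sym.mem_cons_of_mem ha), rfl⟩
      · left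
        intro a ha
        have h1 := Finset.mem_range.1 (h a ha)
        have : a ≠ m := fun e => hmt (e ▸ ha)
        exact Finset.mem_range.2 (by omega)
    · rintro (h | ⟨s, hs, rfl⟩) a ha
      · have h1 := Finset.mem_range.1 (h a ha)
        exact Finset.mem_range.2 (by omega)
      · rcases Sym.mem_cons.1 ha with rfl | h
        · simp
        · exact hs a h
  rw [hU, Finset.sum_union, Finset.sum_image, Finset.mul_sum]
  · congr 1
    apply Finset.sum_congr rfl
    intro t _
    simp [Sym.coe_cons]
  · intro s _ t _ h
    exact Sym.cons_inj_right _ _ _ |>.1 h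
  · rw [Finset.disjoint_left]
    intro S hS hT
    obtain ⟨T, _, rfl⟩ := Finset.mem_image.1 hT
    exact hm (Finset.mem_sym_iff.1 hS m (Sym.mem_cons_self _ _))

/-- generating series -/
noncomputable def auxE {R : Type*} [CommRing R] (x : ℕ → R) (m : ℕ) : PowerSeries R :=
  PowerSeries.mk fun j => (-1)^j * esym x m j

/-- generating series -/
noncomputable def auxH {R : Type*} [CommRing R] (x : ℕ → R) (m : ℕ) : PowerSeries R :=
  PowerSeries.mk fun j => hsym x m j

theorem auxE_succ {R : Type*} [CommRing R] (x : ℕ → R) (m : ℕ) :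
    auxE x (m+1) = auxE x m - PowerSeries.C (x m) * (auxE x m * PowerSeries.X) := by
  ext j
  cases j with
  | zero => simp [auxE, aux_esym_zero]
  | succ j =>
    rw [map_sub, PowerSeries.coeff_C_mul, PowerSeries.coeff_succ_mul_X]
    simp only [auxE, PowerSeries.coeff_mk, aux_esym_succ]
    ring

theorem auxH_succ {R : Type*} [CommRing R] (x : ℕ → R) (m : ℕ) :
    auxH x (m+1) = auxH x m + PowerSeries.C (x m) * (auxH x (m+1) * PowerSeries.X) := by
  ext j
  cases j with
  | zero => simp [auxH, aux_hsym_zero]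
  | succ j =>
    rw [map_add, PowerSeries.coeff_C_mul, PowerSeries.coeff_succ_mul_X]
    simp only [auxH, PowerSeries.coeff_mk, aux_hsym_succ]

theorem auxEH {R : Type*} [CommRing R] (x : ℕ → R) (m : ℕ) : auxE x m * auxH x m = 1 := by
  induction m with
  | zero =>
    have h1 : auxE x 0 = 1 := by
      ext j
      cases j with
      | zero => simp [auxE, aux_esym_zero]
      | succ j => 
        have h0 : Finset.powersetCard (j+1) (∅ : Finset ℕ) = ∅ :=
          Finset.powersetCard_eq_empty.2 (by simp)
        simp [auxE, esym, PowerSeries.coeff_one, h0]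
    have h2 : auxH x 0 = 1 := by
      ext j
      cases j with
      | zero => simp [auxH, aux_hsym_zero]
      | succ j => simp [auxH, hsym, PowerSeries.coeff_one]
    rw [h1, h2, one_mul]
  | succ m ih =>
    rw [auxE_succ]
    linear_combination ih + auxE x m * auxH_succ x m

theorem auxEH_coeff {R : Type*} [CommRing R] (x : ℕ → R) (m d : ℕ) :
    ∀ j, d < j → PowerSeries.coeff j (auxE x (m+d) * auxH x m) = 0 := by
  induction d with
  | zero =>
    intro j hj
    rw [add_zero, auxEH, PowerSeries.coeff_one, if_neg (by omega)]
  | succ d ih =>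
    intro j hj
    obtain ⟨j, rfl⟩ : ∃ i, j = i + 1 := ⟨j - 1, by omega⟩
    have : auxE x (m + (d+1)) * auxH x m = auxE x (m+d) * auxH x m
        - PowerSeries.C (x (m+d)) * (auxE x (m+d) * auxH x m * PowerSeries.X) := by
      rw [← add_assoc, auxE_succ]; ring
    rw [this, map_sub, PowerSeries.coeff_C_mul, PowerSeries.coeff_succ_mul_X,
      ih _ (by omega), ih _ (by omega)]
    simp

/-- The infinite lower-triangular matrices E = [(-1)^(n-k) e_(n-k)(x_1,...,x_n)] and
H = [h_(n-k)(x_1,...,x_(k+1))] are inverse: EH = I. -/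
theorem esym_hsym_matrix_inverse {R : Type*} [CommRing R] (x : ℕ → R) (n k : ℕ) :
    ∑ i ∈ Finset.range (n+1), (-1 : R)^(n-i) * esym x n (n-i) *
        (if k ≤ i then hsym x (k+1) (i-k) else 0)
      = if n = k then 1 else 0 := by
  rcases lt_trichotomy n k with h | rfl | h
  · rw [if_neg (by omega)]
    apply Finset.sum_eq_zero
    intro i hi
    have := Finset.mem_range.1 hi
    rw [if_neg (by omega), mul_zero]
  · rw [if_pos rfl, Finset.sum_eq_single n]
    · simp [aux_esym_zero, aux_hsym_zero]
    · intro i hi hne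
      have := Finset.mem_range.1 hi
      rw [if_neg (by omega), mul_zero]
    · simp
  · rw [if_neg (by omega)]
    obtain ⟨d, rfl⟩ : ∃ d, n = k + 1 + d := ⟨n - (k+1), by omega⟩
    have key := auxEH_coeff x (k+1) d (d+1) (by omega)
    rw [mul_comm, PowerSeries.coeff_mul, Finset.Nat.sum_antidiagonal_eq_sum_range_succ_mk] at key
    rw [show k + 1 + d + 1 = k + (d + 1 + 1) by ring, Finset.sum_range_add, Finset.sum_eq_zero,
      zero_add, ← key]
    · apply Finset.sum_congr rfl
      intro i hi
      have := Finset.mem_range.1 hi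
      rw [if_pos (by omega), show k + 1 + d - (k + i) = d + 1 - i by omega,
        Nat.add_sub_cancel_left]
      simp only [auxE, auxH, PowerSeries.coeff_mk]
      ring
    · intro i hi
      have := Finset.mem_range.1 hi
      rw [if_neg (by omega), mul_zero]
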